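/- Let a ∈ (0,1). There exist A ∈ (0,1) and ε₁ > 0, depending on a, such that for every y ∈ [−π, π]: (i) Re[S_a(−A|y| + iy)] ≥ ε₁·(1 + A²)^{3/2}·|y|³; (ii) Re[S_a(A|y| + iy)] ≤ −ε₁·(1 + A²)^{3/2}·|y|³; and (iii) Re[R_a(iy)] ≤ −ε₁·y². (Note that for z = ±A|y| + iy one has |z|³ = (1 + A²)^{3/2}·|y|³, so (i) and (ii) say that Re[S_a] is at least ε₁|z|³ on the left-opening wedge contour and at most −ε₁|z|³ on the right-opening wedge contour.) -/

import Mathlib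

noncomputable def Sa (a : ℝ) (z : ℂ) : ℂ :=
  Complex.log (1 + (a : ℂ) * Complex.exp z) - Complex.log (1 + (a : ℂ) * Complex.exp (-z)) -
    2 * (a : ℂ) * z / (1 + (a : ℂ))

noncomputable def Ra (a : ℝ) (z : ℂ) : ℂ :=
  Complex.log (1 + (a : ℂ) * Complex.exp (-z)) - Complex.log (1 + (a : ℂ)) +
    (a : ℂ) * z / (1 + (a : ℂ))

noncomputable def auxF (a c x : ℝ) : ℝ :=
  1 / 2 * Real.log (1 + 2 * a * c * Real.exp x + (a * Real.exp x) ^ 2)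
    - 1 / 2 * Real.log (1 + 2 * a * c * Real.exp (-x) + (a * Real.exp (-x)) ^ 2)
    - 2 * a / (1 + a) * x

lemma re_log_aux (a x y : ℝ) :
    (Complex.log (1 + (a : ℂ) * Complex.exp ((x : ℂ) + Complex.I * (y : ℂ)))).re
      = 1 / 2 * Real.log (1 + 2 * a * Real.cos y * Real.exp x + (a * Real.exp x) ^ 2) := by
  have h : Complex.normSq (1 + (a : ℂ) * Complex.exp ((x : ℂ) + Complex.I * (y : ℂ)))
      = 1 + 2 * a * Real.cos y * Real.exp x + (a * Real.exp x) ^ 2 := by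
    rw [Complex.normSq_apply]
    simp [Complex.exp_re, Complex.exp_im]
    have := Real.sin_sq_add_cos_sq y
    linear_combination (a ^ 2 * Real.exp x ^ 2) * this
  rw [Complex.log_re, ← h, Complex.normSq_eq_norm_sq, Real.log_pow]
  push_cast
  ring

lemma re_Sa_aux (a x y : ℝ) :
    (Sa a ((x : ℂ) + Complex.I * (y : ℂ))).re = auxF a (Real.cos y) x := by
  have h2 := re_log_aux a (-x) (-y)
  have e : -((x : ℂ) + Complex.I * (y : ℂ)) = ((-x : ℝ) : ℂ) + Complex.I * ((-y : ℝ) : ℂ) := by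
    push_cast; ring
  have e3 : 2 * (a : ℂ) * ((x : ℂ) + Complex.I * (y : ℂ)) / (1 + (a : ℂ))
      = ((2 * a / (1 + a) * x : ℝ) : ℂ) + ((2 * a / (1 + a) * y : ℝ) : ℂ) * Complex.I := by
    push_cast; ring
  unfold Sa auxF
  rw [e3, e, Complex.sub_re, Complex.sub_re, re_log_aux, re_log_aux, Real.cos_neg,
    Complex.add_re, Complex.re_ofReal_mul, Complex.I_re, Complex.ofReal_re, mul_zero, add_zero]

lemma re_Ra_aux (a y : ℝ) (ha : 0 < 1 + a) :
    (Ra a (Complex.I * (y : ℂ))).re =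
      1 / 2 * Real.log (1 + 2 * a * Real.cos y + a ^ 2) - Real.log (1 + a) := by
  have e : -(Complex.I * (y : ℂ)) = ((0 : ℝ) : ℂ) + Complex.I * ((-y : ℝ) : ℂ) := by
    push_cast; ring
  have e3 : (a : ℂ) * (Complex.I * (y : ℂ)) / (1 + (a : ℂ))
      = ((a / (1 + a) * y : ℝ) : ℂ) * Complex.I := by
    push_cast; ring
  have e4 : (1 + (a : ℂ)) = ((1 + a : ℝ) : ℂ) := by push_cast; rfl
  unfold Ra
  rw [e3, e, Complex.add_re, Complex.sub_re, re_log_aux, e4, Complex.log_ofReal_re, Real.cos_neg,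
    Complex.re_ofReal_mul, Complex.I_re, mul_zero, add_zero]
  simp

lemma auxF_neg (a c x : ℝ) : auxF a c (-x) = - auxF a c x := by
  unfold auxF
  rw [neg_neg]; ring

lemma poly_aux (a c d : ℝ) (ha0 : 0 < a) (ha1 : a < 1) (hc : -1 ≤ c) (hc1 : c ≤ 1)
    (hd0 : 0 ≤ d) (hd1 : d ≤ 1) :
    (1 + a) * (c * (2*a+d) + 4*c^2*a^2 + 3*c*a^2*(2*a+d) + ((2*a+d)^2 - 2*a^2) + 2*a^4)
     - 2*a*(1 + 2*c*(2*a+d) + ((2*a+d)^2 - 2*a^2) + 4*c^2*a^2 + 2*c*a^2*(2*a+d) + a^4)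
     ≤ -(2*a*(1-a)^3*(1-c)) + 100 * d := by
  have hE : (1 + a) * (c * (2*a+d) + 4*c^2*a^2 + 3*c*a^2*(2*a+d) + ((2*a+d)^2 - 2*a^2) + 2*a^4)
     - 2*a*(1 + 2*c*(2*a+d) + ((2*a+d)^2 - 2*a^2) + 4*c^2*a^2 + 2*c*a^2*(2*a+d) + a^4)
     = -(2*a*(1-a)*(1-c)*(1+2*a*c+a^2))
       + d * ((1+a)*(c+3*c*a^2+4*a) - 2*a*(2*c+4*a+2*c*a^2)) + d^2*(1-a) := by ring
  rw [hE]
  have h1 : 2*a*(1-a)^3*(1-c) ≤ 2*a*(1-a)*(1-c)*(1+2*a*c+a^2) := by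
    have : 0 ≤ 2*a*(1-a)*(1-c) * (2*a*(1+c)) := by
      have := sub_pos.2 ha1
      have := sub_nonneg.2 hc1
      have : 0 ≤ 1 + c := by linarith
      positivity
    linarith [this]
  have h2 : (1+a)*(c+3*c*a^2+4*a) - 2*a*(2*c+4*a+2*c*a^2) ≤ 99 := by
    have ha2 : a^2 ≤ 1 := by nlinarith
    have i1 : c+3*c*a^2+4*a ≤ 8 := by nlinarith [mul_nonneg (sub_nonneg.2 hc1) (sq_nonneg a)]
    have i2 : -8 ≤ 2*c+4*a+2*c*a^2 := by
      nlinarith [mul_nonneg (by linarith : 0 ≤ 1 + c) (sq_nonneg a)]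
    nlinarith
  have h3 : d^2*(1-a) ≤ d := by nlinarith [mul_nonneg (sq_nonneg d) ha0.le]
  nlinarith [mul_le_mul_of_nonneg_left h2 hd0]

set_option maxHeartbeats 1000000 in
lemma deriv_aux (a c x m : ℝ) (ha0 : 0 < a) (ha1 : a < 1) (hc : -1 ≤ c) (hc1 : c ≤ 1)
    (hx0 : 0 ≤ x) (hx1 : x ≤ (1 - a) / 2) (hm0 : 0 ≤ m)
    (hm : -(2*a*(1-a)^3*(1-c)) + 200 * a * x ^ 2 ≤ - (128 * m)) :
    ∃ f', HasDerivAt (auxF a c) f' x ∧ f' ≤ -m := by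
  obtain ⟨u, hu⟩ : ∃ u, u = a * Real.exp x := ⟨_, rfl⟩
  obtain ⟨v, hv⟩ : ∃ v, v = a * Real.exp (-x) := ⟨_, rfl⟩
  have huv : u * v = a ^ 2 := by
    rw [hu, hv, Real.exp_neg]
    field_simp
  have hu0 : 0 < u := by rw [hu]; positivity
  have hv0 : 0 < v := by rw [hv]; positivity
  have hx2 : x ^ 2 ≤ 1 / 4 := by nlinarith
  have hu1 : u < 1 := by
    have h1 : a ≤ Real.exp (a - 1) := by linarith [Real.add_one_le_exp (a - 1)]
    calc u ≤ Real.exp (a - 1) * Real.exp x := by rw [hu]; gcongr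
      _ = Real.exp (a - 1 + x) := (Real.exp_add _ _).symm
      _ < 1 := by rw [Real.exp_lt_one_iff]; linarith
  have hv1 : v < 1 := by
    have : Real.exp (-x) ≤ 1 := by rw [Real.exp_le_one_iff]; linarith
    rw [hv]; nlinarith
  obtain ⟨d, hd⟩ : ∃ d, d = u + v - 2 * a := ⟨_, rfl⟩
  have hcosh : u + v = 2 * a * Real.cosh x := by rw [hu, hv, Real.cosh_eq]; ring
  have hd0 : 0 ≤ d := by
    have := Real.one_le_cosh x
    rw [hd, hcosh]; nlinarith
  have hdx : d ≤ 2 * a * x ^ 2 := by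
    have h1 := Real.cosh_le_exp_half_sq x
    have h2 : Real.exp (x^2/2) ≤ 1 + x^2 := by
      have h3 := Real.add_one_le_exp (-(x^2/2))
      rw [Real.exp_neg] at h3
      have h4 := Real.exp_pos (x^2/2)
      have h5 : (-(x^2/2) + 1) * Real.exp (x^2/2) ≤ 1 := by
        calc _ ≤ (Real.exp (x^2/2))⁻¹ * Real.exp (x^2/2) := by gcongr
          _ = 1 := inv_mul_cancel₀ h4.ne'
      nlinarith [sq_nonneg x]
    rw [hd, hcosh]; nlinarith
  have hd1 : d ≤ 1 := by nlinarith
  have hpoly := poly_aux a c d ha0 ha1 hc hc1 hd0 hd1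
  have hp : 2 * a + d = u + v := by rw [hd]; ring
  rw [hp] at hpoly
  have hP : 0 < 1 + 2*c*u + u^2 := by nlinarith [mul_nonneg (by linarith : 0 ≤ 1 + c) hu0.le, mul_pos (sub_pos.2 hu1) (sub_pos.2 hu1)]
  have hQ : 0 < 1 + 2*c*v + v^2 := by nlinarith [mul_nonneg (by linarith : 0 ≤ 1 + c) hv0.le, mul_pos (sub_pos.2 hv1) (sub_pos.2 hv1)]
  have hP4 : 1 + 2*c*u + u^2 ≤ 4 := by nlinarith
  have hQ4 : 1 + 2*c*v + v^2 ≤ 4 := by nlinarith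
  have hder : HasDerivAt (auxF a c) ((c*u+u^2)/(1 + 2*c*u + u^2) + (c*v+v^2)/(1 + 2*c*v + v^2)
      - 2 * a / (1 + a)) x := by
    have e1 : HasDerivAt (fun x => Real.exp x) (Real.exp x) x := Real.hasDerivAt_exp x
    have e2 : HasDerivAt (fun x => Real.exp (-x)) (Real.exp (-x) * (-1)) x :=
      (hasDerivAt_neg x).exp
    have eP : 1 + 2 * a * c * Real.exp x + (a * Real.exp x) ^ 2 = 1 + 2*c*u + u^2 := by
      rw [hu]; ring
    have eQ : 1 + 2 * a * c * Real.exp (-x) + (a * Real.exp (-x)) ^ 2 = 1 + 2*c*v + v^2 := by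
      rw [hv]; ring
    have d1 := ((((e1.const_mul (2*a*c)).const_add 1).add ((e1.const_mul a).pow 2)).log
      (by simpa using (eP ▸ hP).ne')).const_mul (1/2)
    have d2 := ((((e2.const_mul (2*a*c)).const_add 1).add ((e2.const_mul a).pow 2)).log
      (by simpa using (eQ ▸ hQ).ne')).const_mul (1/2)
    have d3 := (hasDerivAt_id x).const_mul (2 * a / (1 + a))
    have d4 := (d1.sub d2).sub d3
    refine HasDerivAt.congr_deriv d4 ?_
    · simp only [Pi.add_apply, Pi.pow_apply]
      rw [eP, eQ, ← hu, ← hv]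
      have t1 : 2 * a * c * Real.exp x = 2 * c * u := by rw [hu]; ring
      have t2 : 2 * a * c * (Real.exp (-x) * -1) = - (2 * c * v) := by rw [hv]; ring
      have t3 : a * (Real.exp (-x) * -1) = - v := by rw [hv]; ring
      rw [t1, t2, t3]
      push_cast
      ring
  refine ⟨_, hder, ?_⟩
  have hPQ : (1 + 2*c*u + u^2) * (1 + 2*c*v + v^2) = 1 + 2*c*(u+v) + ((u+v)^2 - 2*a^2) + 4*c^2*a^2 + 2*c*a^2*(u+v) + a^4 := by
    rw [show a^4 = (a^2)^2 by ring, ← huv]; ring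
  have hN : (c*u+u^2) * (1 + 2*c*v + v^2) + (c*v+v^2) * (1 + 2*c*u + u^2) = c * (u+v) + 4*c^2*a^2 + 3*c*a^2*(u+v) + ((u+v)^2 - 2*a^2) + 2*a^4 := by
    rw [show a^4 = (a^2)^2 by ring, ← huv]; ring
  rw [← hPQ, ← hN] at hpoly
  have ha' : 0 < 1 + a := by linarith
  rw [div_add_div _ _ hP.ne' hQ.ne', div_sub_div _ _ (mul_pos hP hQ).ne' ha'.ne', div_le_iff₀ (by positivity)]
  have hb : (1 + 2*c*u + u^2) * (1 + 2*c*v + v^2) * (1 + a) ≤ 128 := by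
    have : (1 + 2*c*u + u^2) * (1 + 2*c*v + v^2) ≤ 4 * 4 := by gcongr
    nlinarith
  have hb2 := mul_le_mul_of_nonneg_left hb hm0
  have hE : ((c*u+u^2) * (1 + 2*c*v + v^2) + (1 + 2*c*u + u^2) * (c*v+v^2)) * (1 + a)
      - (1 + 2*c*u + u^2) * (1 + 2*c*v + v^2) * (2 * a)
      = (1 + a) * ((c*u+u^2) * (1 + 2*c*v + v^2) + (c*v+v^2) * (1 + 2*c*u + u^2))
      - 2 * a * ((1 + 2*c*u + u^2) * (1 + 2*c*v + v^2)) := by ring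
  rw [hE]
  refine hpoly.trans ?_
  generalize (1 + 2*c*u + u^2) * (1 + 2*c*v + v^2) * (1 + a) = W at hb hb2 ⊢
  clear hE hN hPQ hpoly hder
  linarith

lemma auxF_le (a y : ℝ) (ha0 : 0 < a) (ha1 : a < 1) (hy : |y| ≤ Real.pi) :
    auxF a (Real.cos y) ((1-a)^3/100 * |y|) ≤ -(a*(1-a)^3/400 * y^2) * ((1-a)^3/100 * |y|) := by
  set c := Real.cos y with hcdef
  set X := (1-a)^3/100 * |y| with hX
  have hb : 0 < 1 - a := by linarith
  have hpi := Real.pi_lt_d2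
  have hpi0 := Real.pi_pos
  have hX0 : 0 ≤ X := by positivity
  have hb3 : (1-a)^3 ≤ (1 - a) := by
    calc (1-a)^3 ≤ (1-a)^1 := pow_le_pow_of_le_one hb.le (by linarith) (by norm_num)
      _ = _ := pow_one _
  have hX1 : X ≤ (1-a)/2 := by
    have : X ≤ (1-a)/100 * 4 := by rw [hX]; gcongr; linarith
    linarith
  have hcq : 0.2 * y^2 ≤ 1 - c := by
    have h := Real.cos_le_one_sub_mul_cos_sq hy
    have h2 : (0.2:ℝ) ≤ 2 / Real.pi^2 := by
      rw [le_div_iff₀ (by positivity)]; nlinarith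
    have := mul_le_mul_of_nonneg_right h2 (sq_nonneg y)
    linarith
  have key : ∀ x, 0 ≤ x → x ≤ X → ∃ f', HasDerivAt (auxF a c) f' x ∧ f' ≤ -(a*(1-a)^3/400 * y^2) := by
    intro x hx0 hx1
    apply deriv_aux a c x _ ha0 ha1 (Real.neg_one_le_cos y) (Real.cos_le_one y) hx0 (hx1.trans hX1)
    · positivity
    · have s1 : x^2 ≤ (1-a)^3/10000 * y^2 := by
        calc x^2 ≤ X^2 := by gcongr
          _ = (1-a)^3 * (1-a)^3/10000 * y^2 := by rw [hX, mul_pow, sq_abs]; ring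
          _ ≤ (1-a)^3 * 1/10000 * y^2 := by gcongr; linarith
          _ = _ := by ring
      have s2 : 200 * a * x^2 ≤ 200 * a * ((1-a)^3/10000 * y^2) := by gcongr
      have s3 : 2*a*(1-a)^3*(0.2*y^2) ≤ 2*a*(1-a)^3*(1-c) := by gcongr
      have s4 : 0 ≤ a*(1-a)^3*y^2 := by positivity
      nlinarith
  have h0 : auxF a c 0 = 0 := by unfold auxF; simp
  have := (convex_Icc 0 X).image_sub_le_mul_sub_of_deriv_le (f := auxF a c)
    (C := -(a*(1-a)^3/400 * y^2))
    (fun x hx => by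
      obtain ⟨f', h, _⟩ := key x hx.1 hx.2
      exact h.continuousAt.continuousWithinAt)
    (fun x hx => by
      have hx := interior_subset hx
      obtain ⟨f', h, _⟩ := key x hx.1 hx.2
      exact h.differentiableAt.differentiableWithinAt)
    (fun x hx => by
      have hx := interior_subset hx
      obtain ⟨f', h, h'⟩ := key x hx.1 hx.2
      rw [h.deriv]; exact h') 0 ⟨le_rfl, hX0⟩ X ⟨hX0, le_rfl⟩ hX0
  rw [h0] at this
  linarith

theorem stmt7 (a : ℝ) (ha : a ∈ Set.Ioo (0:ℝ) 1) :
    ∃ A ∈ Set.Ioo (0:ℝ) 1, ∃ ε₁ > 0, ∀ y ∈ Set.Icc (-Real.pi) Real.pi,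
      ε₁ * (1 + A ^ 2) ^ ((3:ℝ)/2) * |y| ^ 3 ≤
          (Sa a (((-(A * |y|) : ℝ) : ℂ) + Complex.I * (y : ℂ))).re ∧
      (Sa a (((A * |y| : ℝ) : ℂ) + Complex.I * (y : ℂ))).re ≤
          -(ε₁ * (1 + A ^ 2) ^ ((3:ℝ)/2) * |y| ^ 3) ∧
      (Ra a (Complex.I * (y : ℂ))).re ≤ -(ε₁ * y ^ 2) := by
  obtain ⟨ha0, ha1⟩ := ha
  have hb : 0 < 1 - a := by linarith
  have hb3 : (1-a)^3 ≤ 1 := pow_le_one₀ hb.le (by linarith)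
  have hb6 : (1-a)^6 ≤ 1 := pow_le_one₀ hb.le (by linarith)
  have hA0 : 0 < (1-a)^3/100 := by positivity
  have hA1 : (1-a)^3/100 < 1 := by linarith
  refine ⟨(1-a)^3/100, ⟨hA0, hA1⟩, a*(1-a)^6/160000, by positivity, ?_⟩
  intro y hy
  have hy' : |y| ≤ Real.pi := abs_le.2 hy
  have hF := auxF_le a y ha0 ha1 hy'
  have hpow : (1 + ((1-a)^3/100) ^ 2) ^ ((3:ℝ)/2) ≤ 4 := by
    calc (1 + ((1-a)^3/100) ^ 2) ^ ((3:ℝ)/2) ≤ (2:ℝ) ^ ((3:ℝ)/2) := by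
          apply Real.rpow_le_rpow (by positivity) (by nlinarith) (by norm_num)
      _ ≤ (2:ℝ) ^ (2:ℝ) := Real.rpow_le_rpow_of_exponent_le (by norm_num) (by norm_num)
      _ = 4 := by norm_num
  have hmain : auxF a (Real.cos y) ((1-a)^3/100 * |y|) ≤
      -(a*(1-a)^6/160000 * (1 + ((1-a)^3/100) ^ 2) ^ ((3:ℝ)/2) * |y| ^ 3) := by
    have h1 : a*(1-a)^6/160000 * (1 + ((1-a)^3/100) ^ 2) ^ ((3:ℝ)/2) * |y| ^ 3
        ≤ a*(1-a)^6/160000 * 4 * |y| ^ 3 := by gcongr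
    have h2 : -(a*(1-a)^3/400 * y^2) * ((1-a)^3/100 * |y|) = -(a*(1-a)^6/160000 * 4 * |y| ^ 3) := by
      rw [← sq_abs y]; ring
    linarith
  refine ⟨?_, ?_, ?_⟩
  · rw [re_Sa_aux, auxF_neg]; linarith
  · rw [re_Sa_aux]; exact hmain
  · rw [re_Ra_aux a y (by linarith)]
    have hcq : 0.2 * y^2 ≤ 1 - Real.cos y := by
      have h := Real.cos_le_one_sub_mul_cos_sq hy'
      have h2 : (0.2:ℝ) ≤ 2 / Real.pi^2 := by
        have hpi := Real.pi_lt_d2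
        have hpi0 := Real.pi_pos
        rw [le_div_iff₀ (by positivity)]; nlinarith
      have := mul_le_mul_of_nonneg_right h2 (sq_nonneg y)
      linarith
    have hpos : 0 < 1 + 2 * a * Real.cos y + a^2 := by
      nlinarith [mul_nonneg ha0.le (by linarith [Real.neg_one_le_cos y] : 0 ≤ 1 + Real.cos y), mul_pos hb hb]
    have h1a : 0 < 1 + a := by linarith
    have hl : Real.log (1 + 2 * a * Real.cos y + a^2) - 2 * Real.log (1 + a)
        ≤ (1 + 2 * a * Real.cos y + a^2) / (1+a)^2 - 1 := by
      have := Real.log_le_sub_one_of_pos (div_pos hpos (pow_pos h1a 2))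
      rw [Real.log_div hpos.ne' (by positivity), Real.log_pow] at this
      push_cast at this
      exact this
    have hr : (1 + 2 * a * Real.cos y + a^2) / (1+a)^2 - 1 ≤ - (a * y^2 / 10) := by
      rw [sub_le_iff_le_add, div_le_iff₀ (by positivity)]
      have q1 : 0 ≤ a * y^2 := by positivity
      have q2 : (1+a)^2 ≤ 4 := by nlinarith
      have q3 := mul_le_mul_of_nonneg_left q2 q1
      have q4 := mul_le_mul_of_nonneg_left hcq ha0.le
      nlinarith
    have he : a*(1-a)^6/160000 * y^2 ≤ a * 1/160000 * y^2 := by gcongr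
    have q1 : 0 ≤ a * y^2 := by positivity
    linarith
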